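/- arXiv:2112.07530 — 6 statements merged into one kernel-verified Lean document; each statement's English description precedes it below -/
import Mathlib

section
/- Let H be a finite-dimensional complex inner product space, let ψ ∈ H be a unit vector, and let Q₁, …, Q_q be orthogonal projections on H such that ‖ψ − Q_i ψ‖² ≤ ε_i for every i ∈ {1, …, q}. Then there exists z ∈ ℂ with |z| = 1 such that ‖ψ − z · (Q_q Q_{q−1} ⋯ Q₁ ψ)‖² ≤ 2 · Σ_{i=1}^{q} ε_i. -/
/-- A self-adjoint idempotent `P` makes `x - P x` orthogonal to the range of `P`. -/
lemma inner_sub_apply_apply_eq_zero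
    {H : Type*} [NormedAddCommGroup H] [InnerProductSpace ℂ H] [CompleteSpace H]
    {P : H →L[ℂ] H} (hidem : IsIdempotentElem P) (hsa : IsSelfAdjoint P) (x y : H) :
    inner ℂ (x - P x) (P y) = 0 := by
  have hPP : P (P x) = P x := congrArg (fun T : H →L[ℂ] H => T x) hidem.eq
  have hsymm : inner ℂ (P (x - P x)) y = inner ℂ (x - P x) (P y) := hsa.isSymmetric _ _
  rw [← hsymm, map_sub, hPP, sub_self, inner_zero_left]

/-- Applying an orthogonal projection `P` to `x` increases the squared distance to `ψ` by at most
`‖ψ - P ψ‖ ^ 2`. -/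
lemma norm_sub_apply_sq_le
    {H : Type*} [NormedAddCommGroup H] [InnerProductSpace ℂ H] [CompleteSpace H]
    {P : H →L[ℂ] H} (hidem : IsIdempotentElem P) (hsa : IsSelfAdjoint P) (ψ x : H) :
    ‖ψ - P x‖ ^ 2 ≤ ‖ψ - P ψ‖ ^ 2 + ‖ψ - x‖ ^ 2 := by
  have hψ := norm_add_sq_eq_norm_sq_add_norm_sq_of_inner_eq_zero _ _
    (inner_sub_apply_apply_eq_zero hidem hsa ψ (ψ - x))
  have hx := norm_add_sq_eq_norm_sq_add_norm_sq_of_inner_eq_zero _ _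
    (inner_sub_apply_apply_eq_zero hidem hsa (ψ - x) (ψ - x))
  rw [map_sub, sub_add_sub_cancel] at hψ
  rw [sub_add_cancel, map_sub] at hx
  nlinarith [mul_self_nonneg ‖ψ - x - (P ψ - P x)‖]

/-- The squared distance from `ψ` to `Q (q-1) ⋯ Q 0 ψ` is at most the sum of the squared
distances from `ψ` to `Q i ψ`. -/
lemma norm_sub_reverse_prod_apply_sq_le
    {H : Type*} [NormedAddCommGroup H] [InnerProductSpace ℂ H] [CompleteSpace H]
    (ψ : H) (q : ℕ) (Q : Fin q → H →L[ℂ] H)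
    (hidem : ∀ i, IsIdempotentElem (Q i)) (hsa : ∀ i, IsSelfAdjoint (Q i)) :
    ‖ψ - (List.ofFn Q).reverse.prod ψ‖ ^ 2 ≤ ∑ i, ‖ψ - Q i ψ‖ ^ 2 := by
  induction q with
  | zero => simp
  | succ n ih =>
    have hstep := norm_sub_apply_sq_le (hidem (Fin.last n)) (hsa (Fin.last n)) ψ
      ((List.ofFn fun i : Fin n => Q i.castSucc).reverse.prod ψ)
    have hprev := ih (fun i => Q i.castSucc) (fun i => hidem _) (fun i => hsa _)
    rw [List.ofFn_succ', List.concat_eq_append, List.reverse_append, List.reverse_singleton,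
      List.singleton_append, List.prod_cons, ContinuousLinearMap.mul_def,
      ContinuousLinearMap.comp_apply,
      Fin.sum_univ_castSucc]
    linarith

/-- Gentle measurement with a phase correction: there is a unit-modulus scalar `z` such
that `ψ` is close to `z • (Q (q-1) ⋯ Q 0) ψ`, with squared distance at most `2 ∑ ε i`. -/
theorem gentle_measurement_phase
    {H : Type*} [NormedAddCommGroup H] [InnerProductSpace ℂ H] [FiniteDimensional ℂ H]
    (ψ : H) (hψ : ‖ψ‖ = 1) (q : ℕ) (Q : Fin q → H →L[ℂ] H) (ε : Fin q → ℝ)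
    (hidem : ∀ i, IsIdempotentElem (Q i)) (hsa : ∀ i, IsSelfAdjoint (Q i))
    (hbound : ∀ i, ‖ψ - Q i ψ‖ ^ 2 ≤ ε i) :
    ∃ z : ℂ, ‖z‖ = 1 ∧ ‖ψ - z • (((List.ofFn Q).reverse.prod) ψ)‖ ^ 2 ≤ 2 * ∑ i, ε i := by
  have hdist := norm_sub_reverse_prod_apply_sq_le ψ q Q hidem hsa
  have hsum : ∑ i, ‖ψ - Q i ψ‖ ^ 2 ≤ ∑ i, ε i := Finset.sum_le_sum fun i _ => hbound i
  refine ⟨1, norm_one, ?_⟩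
  rw [one_smul]
  linarith [sq_nonneg ‖ψ - (List.ofFn Q).reverse.prod ψ‖]
end

section
/- Let X be a finite nonempty type of cardinality N and E a finite nonempty type, and let ψ ∈ EuclideanSpace ℂ (X × Equiv.Perm X × E) with ‖ψ‖ ≤ 1, where the first coordinate is interpreted as an output value y, the second as a permutation π of X, and the third as an auxiliary index. For s₀, s₁ ∈ X with s₀ ≠ s₁ define m(s₀, s₁) = Σ over all triples (y, π, e) with π(s₀) = y or π(s₁) = y of |ψ(y, π, e)|², and define m(s₀, s₁) = 0 if s₀ = s₁. Then the average over all pairs, (1/N²) · Σ_{s₀ ∈ X} Σ_{s₁ ∈ X} m(s₀, s₁), is at most 2/N. -/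
/-- For every `s`, let `m s` be the mass of `ψ` on basis states with `π s = y`. Each basis
state is counted for exactly one `s`, so these masses add up to `‖ψ‖ ^ 2`. -/
theorem sum_mass_perm_apply_eq {X E : Type*} [Fintype X] [Fintype E] [DecidableEq X]
    (ψ : EuclideanSpace ℂ (X × Equiv.Perm X × E)) :
    ∑ s : X, ∑ y : X, ∑ π : Equiv.Perm X, ∑ e : E,
      (if π s = y then ‖ψ (y, π, e)‖ ^ 2 else 0) = ‖ψ‖ ^ 2 := by
  rw [EuclideanSpace.norm_sq_eq, Fintype.sum_prod_type, Finset.sum_comm]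
  refine Finset.sum_congr rfl fun y _ => ?_
  rw [Fintype.sum_prod_type, Finset.sum_comm]
  refine Finset.sum_congr rfl fun π _ => ?_
  rw [Finset.sum_comm]
  refine Finset.sum_congr rfl fun e _ => ?_
  simp [← Equiv.eq_symm_apply]

/-- Inverse-query projector bound in the resampling lemma for permutations: for `ψ`
with `‖ψ‖ ≤ 1` over registers `(y, π, e)`, the average over uniform `s₀, s₁` of the
mass of `ψ` on basis states with `π s₀ = y` or `π s₁ = y` (taken to be `0` when
`s₀ = s₁`) is at most `2 / N`. -/
theorem avg_inverse_proj_mass_le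
    {X E : Type*} [Fintype X] [Fintype E] [Nonempty X] [Nonempty E] [DecidableEq X]
    (ψ : EuclideanSpace ℂ (X × Equiv.Perm X × E)) (hψ : ‖ψ‖ ≤ 1) :
    (1 / (Fintype.card X : ℝ) ^ 2) *
      ∑ s₀ : X, ∑ s₁ : X,
        (if s₀ = s₁ then 0 else
          ∑ y : X, ∑ π : Equiv.Perm X, ∑ e : E,
            (if π s₀ = y ∨ π s₁ = y then ‖ψ (y, π, e)‖ ^ 2 else 0))
      ≤ 2 / (Fintype.card X : ℝ) := by
  set f : X → ℝ := fun s => ∑ y : X, ∑ π : Equiv.Perm X, ∑ e : E,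
    (if π s = y then ‖ψ (y, π, e)‖ ^ 2 else 0) with hf
  have f_nonneg (s : X) : 0 ≤ f s := by
    simp only [hf]
    positivity
  have sum_f_le : ∑ s, f s ≤ 1 :=
    (sum_mass_perm_apply_eq ψ).trans_le (pow_le_one₀ (norm_nonneg ψ) hψ)
  have union_bound (s₀ s₁ : X) :
      (if s₀ = s₁ then 0 else
        ∑ y : X, ∑ π : Equiv.Perm X, ∑ e : E,
          (if π s₀ = y ∨ π s₁ = y then ‖ψ (y, π, e)‖ ^ 2 else 0)) ≤ f s₀ + f s₁ := by
    split_ifs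
    · exact add_nonneg (f_nonneg s₀) (f_nonneg s₁)
    · simp only [hf, ← Finset.sum_add_distrib]
      gcongr with y _ π _ e _
      have := sq_nonneg ‖ψ (y, π, e)‖
      split_ifs <;> first | tauto | linarith
  have card_pos : (0 : ℝ) < Fintype.card X := by exact_mod_cast Fintype.card_pos
  calc
    _ ≤ (1 / (Fintype.card X : ℝ) ^ 2) * ∑ s₀ : X, ∑ s₁ : X, (f s₀ + f s₁) := by
      gcongr with s₀ _ s₁ _
      exact union_bound s₀ s₁
    _ = 2 / (Fintype.card X : ℝ) * ∑ s, f s := by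
      simp only [Finset.sum_add_distrib, Finset.sum_const, Finset.card_univ, nsmul_eq_mul,
        ← Finset.mul_sum]
      field_simp
      ring
    _ ≤ 2 / (Fintype.card X : ℝ) := mul_le_of_le_one_right (by positivity) sum_f_le
end

section
/- Let X be a finite type with decidable equality, let Y be a finite additive abelian group, and fix s₀, s₁ ∈ X. On H = EuclideanSpace ℂ (X × Y × (X → Y)), define linear maps by their action on standard basis vectors e_{(x,y,f)}: the forward oracle O sends e_{(x,y,f)} to e_{(x, y + f(x), f)}; the register swap S sends e_{(x,y,f)} to e_{(x, y, f ∘ swap_{s₀,s₁})}; and the projection Π sends e_{(x,y,f)} to itself if x ∉ {s₀, s₁} and to 0 otherwise. Then S ∘ (O ∘ Π) = (O ∘ Π) ∘ S. -/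
/-- Commutation of the forward superposition-oracle query (projected away from
`{s₀, s₁}`) with the register swap `Swap_{F_{s₀} F_{s₁}}`:
`S ∘ (O ∘ Π) = (O ∘ Π) ∘ S`. -/
theorem swap_comm_forward_query
    {X Y : Type*} [Fintype X] [DecidableEq X] [Fintype Y] [AddCommGroup Y] [DecidableEq Y]
    (s₀ s₁ : X)
    (O S Pr : EuclideanSpace ℂ (X × Y × (X → Y)) →ₗ[ℂ] EuclideanSpace ℂ (X × Y × (X → Y)))
    (hO : ∀ (x : X) (y : Y) (f : X → Y),
      O (EuclideanSpace.single (x, y, f) 1) = EuclideanSpace.single (x, y + f x, f) 1)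
    (hS : ∀ (x : X) (y : Y) (f : X → Y),
      S (EuclideanSpace.single (x, y, f) 1) =
        EuclideanSpace.single (x, y, fun z => f (Equiv.swap s₀ s₁ z)) 1)
    (hPr : ∀ (x : X) (y : Y) (f : X → Y),
      Pr (EuclideanSpace.single (x, y, f) 1) =
        if x = s₀ ∨ x = s₁ then 0 else EuclideanSpace.single (x, y, f) 1) :
    S ∘ₗ (O ∘ₗ Pr) = (O ∘ₗ Pr) ∘ₗ S := by
  refine (EuclideanSpace.basisFun (X × Y × (X → Y)) ℂ).toBasis.ext ?_
  rintro ⟨x, y, f⟩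
  simp only [OrthonormalBasis.coe_toBasis, EuclideanSpace.basisFun_apply,
    LinearMap.comp_apply, hS, hPr]
  by_cases h : x = s₀ ∨ x = s₁
  · simp [h]
  · obtain ⟨h₀, h₁⟩ := not_or.mp h
    simp only [if_neg h, hO, hS, Equiv.swap_apply_of_ne_of_ne h₀ h₁]
end

section
/- Let X be a finite additive abelian group with decidable equality, and fix s₀, s₁ ∈ X. On H = EuclideanSpace ℂ (X × X × (X → X)), define linear maps by their action on standard basis vectors e_{(x,y,f)}: the inverse oracle O^inv sends e_{(x,y,f)} to e_{(x + Σ_{x' : f(x') = y} x', y, f)}, where the sum is over the finite set of preimages of y under f; the register swap S sends e_{(x,y,f)} to e_{(x, y, f ∘ swap_{s₀,s₁})}; and the projection Π^inv sends e_{(x,y,f)} to itself if f(s₀) ≠ y and f(s₁) ≠ y, and to 0 otherwise. Then S ∘ (O^inv ∘ Π^inv) = (O^inv ∘ Π^inv) ∘ S. -/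
/-- A swap of two points outside the fiber of `f` over `y` leaves that fiber unchanged. -/
theorem apply_swap_eq_iff_of_ne {α β : Type*} [DecidableEq α] {f : α → β} {a b : α} {y : β}
    (ha : f a ≠ y) (hb : f b ≠ y) (x : α) : f (Equiv.swap a b x) = y ↔ f x = y := by
  rcases eq_or_ne x a with rfl | hxa
  · simp [ha, hb]
  rcases eq_or_ne x b with rfl | hxb
  · simp [ha, hb]
  rw [Equiv.swap_apply_of_ne_of_ne hxa hxb]

/-- Commutation of the inverse superposition-oracle query (projected away from output
values `f s₀`, `f s₁`) with the register swap `Swap_{F_{s₀} F_{s₁}}`: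
`S ∘ (O⁻ ∘ Π⁻) = (O⁻ ∘ Π⁻) ∘ S`. -/
theorem swap_comm_inverse_query
    {X : Type*} [Fintype X] [DecidableEq X] [AddCommGroup X]
    (s₀ s₁ : X)
    (Oinv S Prinv :
      EuclideanSpace ℂ (X × X × (X → X)) →ₗ[ℂ] EuclideanSpace ℂ (X × X × (X → X)))
    (hOinv : ∀ (x y : X) (f : X → X),
      Oinv (EuclideanSpace.single (x, y, f) 1) =
        EuclideanSpace.single (x + ∑ x' ∈ Finset.univ.filter (fun x' => f x' = y), x', y, f) 1)
    (hS : ∀ (x y : X) (f : X → X),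
      S (EuclideanSpace.single (x, y, f) 1) =
        EuclideanSpace.single (x, y, fun z => f (Equiv.swap s₀ s₁ z)) 1)
    (hPrinv : ∀ (x y : X) (f : X → X),
      Prinv (EuclideanSpace.single (x, y, f) 1) =
        if f s₀ ≠ y ∧ f s₁ ≠ y then EuclideanSpace.single (x, y, f) 1 else 0) :
    S ∘ₗ (Oinv ∘ₗ Prinv) = (Oinv ∘ₗ Prinv) ∘ₗ S := by
  refine (EuclideanSpace.basisFun (X × X × (X → X)) ℂ).toBasis.ext ?_
  rintro ⟨x, y, f⟩
  simp only [OrthonormalBasis.coe_toBasis, EuclideanSpace.basisFun_apply, LinearMap.comp_apply,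
    hS, hPrinv, Equiv.swap_apply_left, Equiv.swap_apply_right]
  by_cases h : f s₀ ≠ y ∧ f s₁ ≠ y
  · simp only [if_pos h, if_pos h.symm, hOinv, hS, apply_swap_eq_iff_of_ne h.1 h.2]
  · rw [if_neg h, if_neg (fun h' => h h'.symm)]
    simp only [map_zero]
end

section
/- Let G = {0,1}^n with bitwise XOR ⊕ (formalizable as the additive group Fin n → ZMod 2), let P be a permutation of G, let k₁, k₂ ∈ G, and let (x₁, y₁), …, (x_t, y_t) ∈ G × G be such that the x_i are pairwise distinct, the y_i are pairwise distinct, and P(x_i ⊕ k₁) ≠ y_j ⊕ k₂ for all i ≠ j. Define the permutation P_{T,k} = swap_{P(x₁ ⊕ k₁), y₁ ⊕ k₂} ∘ swap_{P(x₂ ⊕ k₁), y₂ ⊕ k₂} ∘ ⋯ ∘ swap_{P(x_t ⊕ k₁), y_t ⊕ k₂} ∘ P. Then P_{T,k}(x_i ⊕ k₁) = y_i ⊕ k₂ for every i ∈ {1, …, t}; equivalently, the Even-Mansour cipher E_k[P_{T,k}](x) := P_{T,k}(x ⊕ k₁) ⊕ k₂ satisfies E_k[P_{T,k}](x_i) =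 y_i for all i. -/
theorem List.prod_ofFn_swap_apply_of_ne {α : Type*} [DecidableEq α] {t : ℕ} {a b : Fin t → α}
    {z : α} (ha : ∀ i, z ≠ a i) (hb : ∀ i, z ≠ b i) :
    (List.ofFn fun i => Equiv.swap (a i) (b i)).prod z = z := by
  induction t with
  | zero => simp
  | succ t ih =>
    rw [List.ofFn_succ, List.prod_cons, Equiv.Perm.mul_apply,
      ih (fun i => ha i.succ) (fun i => hb i.succ),
      Equiv.swap_apply_of_ne_of_ne (ha 0) (hb 0)]

theorem List.prod_ofFn_swap_apply {α : Type*} [DecidableEq α] {t : ℕ} {a b : Fin t → α}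
    (ha : Function.Injective a) (hb : Function.Injective b) (hab : ∀ i j, i ≠ j → a i ≠ b j)
    (i : Fin t) : (List.ofFn fun i => Equiv.swap (a i) (b i)).prod (a i) = b i := by
  induction t with
  | zero => exact i.elim0
  | succ t ih =>
    rw [List.ofFn_succ, List.prod_cons, Equiv.Perm.mul_apply]
    cases i using Fin.cases with
    | zero =>
      rw [List.prod_ofFn_swap_apply_of_ne (fun j => ha.ne (Fin.succ_ne_zero j).symm)
        (fun j => hab _ _ (Fin.succ_ne_zero j).symm), Equiv.swap_apply_left]
    | succ i =>
      have h := ih (ha.comp (Fin.succ_injective t)) (hb.comp (Fin.succ_injective t))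
        (fun j k hjk => hab _ _ ((Fin.succ_injective t).ne hjk)) i
      simp only [Function.comp_apply] at h
      rw [h, Equiv.swap_apply_of_ne_of_ne (hab _ _ (Fin.succ_ne_zero i).symm).symm
        (hb.ne (Fin.succ_ne_zero i))]

/-- The reprogrammed permutation `P_{T,k}` of the Even-Mansour analysis: if the `x i`
are pairwise distinct, the `y i` are pairwise distinct, and there are no internal
collisions (`P (x i ⊕ k₁) ≠ y j ⊕ k₂` for `i ≠ j`), then
`P_{T,k} (x i ⊕ k₁) = y i ⊕ k₂` for every `i`, i.e. `E_k[P_{T,k}] (x i) = y i`. -/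
theorem reprogrammed_perm_eval
    (n : ℕ) (P : Equiv.Perm (Fin n → ZMod 2)) (k₁ k₂ : Fin n → ZMod 2)
    (t : ℕ) (x y : Fin t → (Fin n → ZMod 2))
    (hx : Function.Injective x) (hy : Function.Injective y)
    (hcoll : ∀ i j : Fin t, i ≠ j → P (x i + k₁) ≠ y j + k₂) :
    ∀ i : Fin t,
      ((List.ofFn (fun i : Fin t => Equiv.swap (P (x i + k₁)) (y i + k₂))).prod * P)
        (x i + k₁) = y i + k₂ := by
  intro i
  exact List.prod_ofFn_swap_apply
    (P.injective.comp ((add_left_injective k₁).comp hx)) ((add_left_injective k₂).comp hy) hcoll i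
end

section
/- Let G = {0,1}^n with bitwise XOR ⊕ (formalizable as the additive group Fin n → ZMod 2), let P be a permutation of G, let j ∈ ℕ, let (x₁, y₁), …, (x_j, y_j) ∈ G × G, let s₀, s₁, k₁, k₂ ∈ G, and set x_{j+1} := s₀ ⊕ k₁ and y_{j+1} := P(s₁) ⊕ k₂. Assume that for every i ∈ {1, …, j} one has x_i ≠ x_{j+1} and x_i ⊕ k₁ ≠ s₁. Let P₁ := P ∘ swap_{s₀, s₁}. Then swap_{P₁(x₁ ⊕ k₁), y₁ ⊕ k₂} ∘ ⋯ ∘ swap_{P₁(x_j ⊕ k₁), y_j ⊕ k₂} ∘ P₁ = swap_{P(x₁ ⊕ k₁), y₁ ⊕ k₂} ∘ ⋯ ∘ swap_{P(x_j ⊕ k₁), y_j ⊕ k₂} ∘ swap_{P(x_{j+1} ⊕ k₁), y_{j+1} ⊕ k₂} ∘ P; that is, (P₁)_{T_j, k} = P_{T_{j+1}, k}. -/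
/-- Reprogramming consistency in the proof of Lemma 5: with `x_{j+1} = s₀ ⊕ k₁`,
`y_{j+1} = P s₁ ⊕ k₂` and `P₁ = P ∘ swap_{s₀,s₁}`, if no `x i` equals `x_{j+1}` and no
`x i ⊕ k₁` equals `s₁`, then `(P₁)_{T_j,k} = P_{T_{j+1},k}`. -/
theorem reprogrammed_perm_swap_eq
    (n : ℕ) (P : Equiv.Perm (Fin n → ZMod 2)) (j : ℕ)
    (x y : Fin j → (Fin n → ZMod 2)) (s₀ s₁ k₁ k₂ : Fin n → ZMod 2)
    (hx : ∀ i : Fin j, x i ≠ s₀ + k₁)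
    (hs₁ : ∀ i : Fin j, x i + k₁ ≠ s₁) :
    (List.ofFn (fun i : Fin j =>
        Equiv.swap ((P * Equiv.swap s₀ s₁) (x i + k₁)) (y i + k₂))).prod *
      (P * Equiv.swap s₀ s₁)
    = (List.ofFn (fun i : Fin j => Equiv.swap (P (x i + k₁)) (y i + k₂))).prod *
      (Equiv.swap (P ((s₀ + k₁) + k₁)) ((P s₁ + k₂) + k₂) * P) := by
  have add_add_self (a b : Fin n → ZMod 2) : (a + b) + b = a := by
    funext i
    simp [add_assoc, CharTwo.add_self_eq_zero]
  have swap_fix (i : Fin j) : (P * Equiv.swap s₀ s₁) (x i + k₁) = P (x i + k₁) := by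
    have h₀ : x i + k₁ ≠ s₀ := fun h => hx i (by rw [← h, add_add_self])
    rw [Equiv.Perm.mul_apply, Equiv.swap_apply_of_ne_of_ne h₀ (hs₁ i)]
  simp only [swap_fix, add_add_self]
  rw [Equiv.mul_swap_eq_swap_mul]
end
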